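/- Let (w_t)_{t∈[0,1]} be a d-dimensional Brownian motion, w(k) its k-th dyadic polygonal approximation and z(k) = w(k+1) − w(k). Then there exists a constant C_d > 0 depending only on d such that for all k ∈ ℕ and all 0 ≤ s ≤ t ≤ 1, E[ |J[z(k), w(k)]_{s,t}|² ] ≤ C_d · min( 2^{−k}, (t−s)² ). -/

import Mathlib

open MeasureTheory ProbabilityTheory Filter Set

/-- The `k`-th dyadic polygonal approximation of a path `w : ℝ → E`:
the piecewise linear path agreeing with `w` at the dyadic points `l / 2^k`
and affine in between. -/
noncomputable def dyadicApprox {E : Type*} [AddCommGroup E] [Module ℝ E]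
    (w : ℝ → E) (k : ℕ) (t : ℝ) : E :=
  w ((⌊t * 2 ^ k⌋ : ℝ) / 2 ^ k)
    + ((2 : ℝ) ^ k * (t - (⌊t * 2 ^ k⌋ : ℝ) / 2 ^ k)) •
      (w (((⌊t * 2 ^ k⌋ : ℝ) + 1) / 2 ^ k) - w ((⌊t * 2 ^ k⌋ : ℝ) / 2 ^ k))

/-- `w` is a `d`-dimensional Brownian motion on `[0,1]` under the probability
measure `P`: continuous sample paths, `w 0 = 0`, independent increments, and
`w t - w s` is a centered Gaussian vector with covariance `(t - s) • Id`
(formulated as: the `d` coordinates of the increment are independent, each with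
law `gaussianReal 0 (t - s)`). -/
def IsBrownianMotion {Ω : Type*} [MeasurableSpace Ω] (P : Measure Ω) (d : ℕ)
    (w : ℝ → Ω → EuclideanSpace ℝ (Fin d)) : Prop :=
  IsProbabilityMeasure P ∧
  (∀ t : ℝ, Measurable (w t)) ∧
  (∀ ω, Continuous fun t => w t ω) ∧
  (∀ ω, w 0 ω = 0) ∧
  (∀ (n : ℕ) (t : Fin (n + 1) → ℝ), Monotone t → (∀ i, t i ∈ Set.Icc (0 : ℝ) 1) →
    iIndepFun
      (fun (i : Fin n) ω => w (t i.succ) ω - w (t i.castSucc) ω) P) ∧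
  (∀ s t : ℝ, 0 ≤ s → s ≤ t → t ≤ 1 →
    (iIndepFun (fun (i : Fin d) ω => (w t ω - w s ω) i) P ∧
     ∀ i : Fin d,
       P.map (fun ω => (w t ω - w s ω) i) = gaussianReal 0 (Real.toNNReal (t - s))))

/-- Tensor product `ξ ⊗ η` of two vectors of `ℝ^d`, realized as the element
`(i, j) ↦ ξ i * η j` of `EuclideanSpace ℝ (Fin d × Fin d)`, whose norm is the
Hilbert–Schmidt norm (so `|ξ ⊗ η| = |ξ| |η|`). -/
noncomputable def tensor {d : ℕ} (ξ η : EuclideanSpace ℝ (Fin d)) :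
    EuclideanSpace ℝ (Fin d × Fin d) :=
  (WithLp.equiv 2 (Fin d × Fin d → ℝ)).symm fun p => ξ p.1 * η p.2

/-- The iterated integral `J[x,y]_{s,t} = ∫_s^t (x_u - x_s) ⊗ y'(u) du`, where
`y'` is the (almost-everywhere defined) derivative of `y`. -/
noncomputable def Jint {d : ℕ} (x y : ℝ → EuclideanSpace ℝ (Fin d)) (s t : ℝ) :
    EuclideanSpace ℝ (Fin d × Fin d) :=
  ∫ u in s..t, tensor (x u - x s) (deriv y u)

/-- slope of the dyadic approximation -/
noncomputable def dySlope {E : Type*} [AddCommGroup E] [Module ℝ E]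
    (w : ℝ → E) (k : ℕ) (u : ℝ) : E :=
  (2 : ℝ) ^ k • (w (((⌊u * 2 ^ k⌋ : ℝ) + 1) / 2 ^ k) - w ((⌊u * 2 ^ k⌋ : ℝ) / 2 ^ k))

lemma dySlope_coord {d : ℕ} (w : ℝ → EuclideanSpace ℝ (Fin d)) (k : ℕ) (u : ℝ) (i : Fin d) :
    (dySlope w k u) i = dySlope (fun v => w v i) k u := by
  simp [dySlope]

lemma dyadicApprox_coord {d : ℕ} (w : ℝ → EuclideanSpace ℝ (Fin d)) (k : ℕ) (u : ℝ) (i : Fin d) :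
    (dyadicApprox w k u) i = dyadicApprox (fun v => w v i) k u := by
  simp [dyadicApprox]

lemma floor_cell {k : ℕ} {n : ℤ} {u : ℝ} (h1 : (n : ℝ) / 2 ^ k ≤ u) (h2 : u < ((n : ℝ) + 1) / 2 ^ k) :
    ⌊u * 2 ^ k⌋ = n := by
  have hp : (0 : ℝ) < 2 ^ k := by positivity
  rw [Int.floor_eq_iff]
  rw [div_le_iff₀ hp] at h1
  rw [lt_div_iff₀ hp] at h2
  exact ⟨h1, h2⟩

lemma deriv_dyadicApprox {E : Type*} [NormedAddCommGroup E] [NormedSpace ℝ E]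
    (w : ℝ → E) (k : ℕ) (u : ℝ) (hu : ∀ n : ℤ, u ≠ (n : ℝ) / 2 ^ k) :
    deriv (dyadicApprox w k) u = dySlope w k u := by
  have hp : (0 : ℝ) < 2 ^ k := by positivity
  set n := ⌊u * 2 ^ k⌋ with hn
  have h1 : (n : ℝ) / 2 ^ k < u := by
    refine lt_of_le_of_ne ?_ (hu n).symm
    rw [div_le_iff₀ hp]; exact Int.floor_le _
  have h2 : u < ((n : ℝ) + 1) / 2 ^ k := by
    rw [lt_div_iff₀ hp]; exact Int.lt_floor_add_one _
  have hev : dyadicApprox w k =ᶠ[nhds u] fun t => w ((n : ℝ) / 2 ^ k)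
    + ((2 : ℝ) ^ k * (t - (n : ℝ) / 2 ^ k)) •
      (w (((n : ℝ) + 1) / 2 ^ k) - w ((n : ℝ) / 2 ^ k)) := by
    filter_upwards [Ioo_mem_nhds h1 h2] with t ht
    simp only [dyadicApprox, floor_cell ht.1.le ht.2]
  rw [hev.deriv_eq]
  have hd : HasDerivAt (fun t : ℝ => (2 : ℝ) ^ k * (t - (n : ℝ) / 2 ^ k)) ((2 : ℝ) ^ k * 1) u :=
    ((hasDerivAt_id u).sub_const _).const_mul _
  have := (hd.smul_const (w (((n : ℝ) + 1) / 2 ^ k) - w ((n : ℝ) / 2 ^ k))).const_add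
    (w ((n : ℝ) / 2 ^ k))
  rw [this.deriv]
  simp [dySlope, ← hn]

lemma ae_not_dyadic (k : ℕ) : ∀ᵐ u : ℝ, ∀ n : ℤ, u ≠ (n : ℝ) / 2 ^ k := by
  rw [ae_all_iff]
  intro n
  exact Measure.ae_ne volume _

lemma measurable_dyadicApprox {Ω : Type*} [MeasurableSpace Ω] {x : ℝ → Ω → ℝ}
    (hx : Measurable (Function.uncurry x)) (k : ℕ) :
    Measurable (fun p : ℝ × Ω => dyadicApprox (fun u => x u p.2) k p.1) := by
  have hf : Measurable (fun p : ℝ × Ω => ((⌊p.1 * 2 ^ k⌋ : ℤ) : ℝ)) := by fun_prop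
  have h1 : Measurable (fun p : ℝ × Ω => x ((⌊p.1 * 2 ^ k⌋ : ℝ) / 2 ^ k) p.2) :=
    hx.comp ((hf.div_const _).prodMk measurable_snd)
  have h2 : Measurable (fun p : ℝ × Ω => x (((⌊p.1 * 2 ^ k⌋ : ℝ) + 1) / 2 ^ k) p.2) :=
    hx.comp (((hf.add_const _).div_const _).prodMk measurable_snd)
  simp only [dyadicApprox, smul_eq_mul]
  fun_prop

lemma measurable_dySlope {Ω : Type*} [MeasurableSpace Ω] {x : ℝ → Ω → ℝ}
    (hx : Measurable (Function.uncurry x)) (k : ℕ) :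
    Measurable (fun p : ℝ × Ω => dySlope (fun u => x u p.2) k p.1) := by
  have hf : Measurable (fun p : ℝ × Ω => ((⌊p.1 * 2 ^ k⌋ : ℤ) : ℝ)) := by fun_prop
  have h1 : Measurable (fun p : ℝ × Ω => x ((⌊p.1 * 2 ^ k⌋ : ℝ) / 2 ^ k) p.2) :=
    hx.comp ((hf.div_const _).prodMk measurable_snd)
  have h2 : Measurable (fun p : ℝ × Ω => x (((⌊p.1 * 2 ^ k⌋ : ℝ) + 1) / 2 ^ k) p.2) :=
    hx.comp (((hf.add_const _).div_const _).prodMk measurable_snd)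
  simp only [dySlope, smul_eq_mul]
  fun_prop

lemma floor_mem {k : ℕ} {u : ℝ} (h0 : 0 ≤ u) (h1 : u ≤ 1) :
    0 ≤ (⌊u * 2 ^ k⌋ : ℝ) / 2 ^ k ∧ (⌊u * 2 ^ k⌋ : ℝ) / 2 ^ k ≤ u ∧
    u < ((⌊u * 2 ^ k⌋ : ℝ) + 1) / 2 ^ k ∧ ((⌊u * 2 ^ k⌋ : ℝ) + 1) / 2 ^ k ≤ 2 ∧
    (u < 1 → ((⌊u * 2 ^ k⌋ : ℝ) + 1) / 2 ^ k ≤ 1) := by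
  have hp : (0 : ℝ) < 2 ^ k := by positivity
  have hp1 : (1 : ℝ) ≤ 2 ^ k := one_le_pow₀ (by norm_num)
  have hf := Int.floor_le (u * 2 ^ k)
  have hf0 : (0 : ℝ) ≤ (⌊u * 2 ^ k⌋ : ℝ) := by
    exact_mod_cast Int.floor_nonneg.2 (by positivity)
  refine ⟨by positivity, ?_, ?_, ?_, ?_⟩
  · rwa [div_le_iff₀ hp]
  · rw [lt_div_iff₀ hp]; exact Int.lt_floor_add_one _
  · rw [div_le_iff₀ hp]; nlinarith
  · intro hu
    rw [div_le_iff₀ hp, one_mul]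
    have : ⌊u * 2 ^ k⌋ < (2 ^ k : ℤ) := by
      rw [Int.floor_lt]; push_cast; nlinarith
    exact_mod_cast this

lemma bdd_dyadicApprox {x : ℝ → ℝ} (hx : Continuous x) (k : ℕ) :
    ∃ M : ℝ, ∀ u, 0 ≤ u → u ≤ 1 → |dyadicApprox x k u| ≤ M := by
  obtain ⟨M, hM⟩ := (isCompact_Icc (a := (0 : ℝ)) (b := 2)).exists_bound_of_continuousOn
    hx.continuousOn
  refine ⟨M + (M + M), fun u h0 h1 => ?_⟩
  obtain ⟨a1, a2, a3, a4, -⟩ := floor_mem (k := k) h0 h1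
  have hp : (0 : ℝ) < 2 ^ k := by positivity
  have e1 := hM _ ⟨a1, by linarith⟩
  have e2 := hM _ ⟨by linarith, a4⟩
  rw [Real.norm_eq_abs] at e1 e2
  have ht0 : 0 ≤ (2 : ℝ) ^ k * (u - (⌊u * 2 ^ k⌋ : ℝ) / 2 ^ k) := by
    apply mul_nonneg hp.le; linarith
  have ht1 : (2 : ℝ) ^ k * (u - (⌊u * 2 ^ k⌋ : ℝ) / 2 ^ k) ≤ 1 := by
    rw [add_div] at a3
    have : u - (⌊u * 2 ^ k⌋ : ℝ) / 2 ^ k ≤ 1 / 2 ^ k := by linarith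
    calc _ ≤ (2 : ℝ) ^ k * (1 / 2 ^ k) := by gcongr
      _ = 1 := by field_simp
  rw [dyadicApprox, smul_eq_mul]
  refine (abs_add_le _ _).trans ?_
  rw [abs_mul, abs_of_nonneg ht0]
  have h3 := (abs_sub (x (((⌊u * 2 ^ k⌋ : ℝ) + 1) / 2 ^ k)) (x ((⌊u * 2 ^ k⌋ : ℝ) / 2 ^ k)))
  have h4 := abs_nonneg (x (((⌊u * 2 ^ k⌋ : ℝ) + 1) / 2 ^ k) - (x ((⌊u * 2 ^ k⌋ : ℝ) / 2 ^ k)))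
  nlinarith

lemma bdd_dySlope {x : ℝ → ℝ} (hx : Continuous x) (k : ℕ) :
    ∃ M : ℝ, ∀ u, 0 ≤ u → u ≤ 1 → |dySlope x k u| ≤ M := by
  obtain ⟨M, hM⟩ := (isCompact_Icc (a := (0 : ℝ)) (b := 2)).exists_bound_of_continuousOn
    hx.continuousOn
  refine ⟨2 ^ k * (M + M), fun u h0 h1 => ?_⟩
  obtain ⟨a1, a2, a3, a4, -⟩ := floor_mem (k := k) h0 h1
  have hp : (0 : ℝ) < 2 ^ k := by positivity
  have e1 := hM _ ⟨a1, by linarith⟩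
  have e2 := hM _ ⟨by linarith, a4⟩
  rw [Real.norm_eq_abs] at e1 e2
  rw [dySlope, smul_eq_mul, abs_mul, abs_of_pos hp]
  gcongr
  have h3 := (abs_sub (x (((⌊u * 2 ^ k⌋ : ℝ) + 1) / 2 ^ k)) (x ((⌊u * 2 ^ k⌋ : ℝ) / 2 ^ k)))
  linarith

/-- scalar `z(k)` -/
noncomputable def dyZ (x : ℝ → ℝ) (k : ℕ) (u : ℝ) : ℝ :=
  dyadicApprox x (k + 1) u - dyadicApprox x k u

/-- scalar integrand -/
noncomputable def dyF (x y : ℝ → ℝ) (k : ℕ) (s u : ℝ) : ℝ :=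
  (dyZ x k u - dyZ x k s) * dySlope y k u

lemma measurable_dyF {Ω : Type*} [MeasurableSpace Ω] {x y : ℝ → Ω → ℝ}
    (hx : Measurable (Function.uncurry x)) (hy : Measurable (Function.uncurry y)) (k : ℕ) (s : ℝ) :
    Measurable (fun p : ℝ × Ω => dyF (fun u => x u p.2) (fun u => y u p.2) k s p.1) := by
  have h1 := measurable_dyadicApprox hx k
  have h2 := measurable_dyadicApprox hx (k + 1)
  have h3 := measurable_dySlope hy k
  have hs : Measurable (fun p : ℝ × Ω => (s, p.2)) := by fun_prop
  have h4 := h1.comp hs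
  have h5 := h2.comp hs
  simp only [Function.comp_def] at h4 h5
  exact ((h2.sub h1).sub (h5.sub h4)).mul h3

lemma intervalIntegrable_dyF {x y : ℝ → ℝ} (hx : Continuous x) (hy : Continuous y) (k : ℕ)
    (s a b : ℝ) (ha : 0 ≤ a) (ha1 : a ≤ 1) (hb : 0 ≤ b) (hb1 : b ≤ 1) :
    IntervalIntegrable (dyF x y k s) volume a b := by
  obtain ⟨M1, h1⟩ := bdd_dyadicApprox hx k
  obtain ⟨M2, h2⟩ := bdd_dyadicApprox hx (k + 1)
  obtain ⟨M3, h3⟩ := bdd_dySlope hy k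
  have hmeas : Measurable (dyF x y k s) := by
    have hx' : Measurable (Function.uncurry (fun (t : ℝ) (_ : Unit) => x t)) :=
      hx.measurable.comp measurable_fst
    have hy' : Measurable (Function.uncurry (fun (t : ℝ) (_ : Unit) => y t)) :=
      hy.measurable.comp measurable_fst
    have h := measurable_dyF hx' hy' k s
    have h' : Measurable (fun u : ℝ => (u, ())) := by fun_prop
    have := h.comp h'
    simp only [Function.comp_def] at this
    exact this
  rw [intervalIntegrable_iff]
  refine Measure.integrableOn_of_bounded (M := (M2 + M1 + |dyZ x k s|) * M3) ?_
    hmeas.aestronglyMeasurable ?_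
  · simp
  · refine (ae_restrict_mem measurableSet_uIoc).mono fun u hu => ?_
    have hu0 : 0 ≤ u := (le_min ha hb).trans hu.1.le
    have hu1 : u ≤ 1 := hu.2.trans (max_le ha1 hb1)
    have := h1 u hu0 hu1
    have := h2 u hu0 hu1
    have := h3 u hu0 hu1
    rw [Real.norm_eq_abs, dyF, abs_mul]
    have e := abs_sub (dyZ x k u) (dyZ x k s)
    have e' := abs_sub (dyadicApprox x (k+1) u) (dyadicApprox x k u)
    have e2 := abs_nonneg (dyadicApprox x k u)
    have e3 := abs_nonneg (dyadicApprox x (k+1) u)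
    have e4 := abs_nonneg (dyZ x k s)
    rw [← dyZ] at e'
    apply mul_le_mul _ ‹_› (abs_nonneg _) (by linarith)
    linarith

lemma integral_cell (x y : ℝ → ℝ) (hx : Continuous x) (hy : Continuous y) (k : ℕ) (s : ℝ) (l : ℕ)
    (hl : l < 2 ^ k) :
    ∫ u in ((l : ℝ) / 2 ^ k)..(((l + 1 : ℕ) : ℝ) / 2 ^ k), dyF x y k s u =
      (2 * x ((2 * l + 1) / 2 ^ (k + 1)) - x (l / 2 ^ k) - x ((l + 1) / 2 ^ k)) / 4
        * (y ((l + 1) / 2 ^ k) - y (l / 2 ^ k))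
      - dyZ x k s * (y ((l + 1) / 2 ^ k) - y (l / 2 ^ k)) := by
  have hp : (0 : ℝ) < 2 ^ k := by positivity
  have hpp : (2 : ℝ) ^ (k + 1) = 2 * 2 ^ k := by ring
  set L := (l : ℝ) / 2 ^ k with hL
  set R := ((l : ℝ) + 1) / 2 ^ k with hR
  set m := (2 * (l : ℝ) + 1) / 2 ^ (k + 1) with hm
  have hmL : m = L + 1 / 2 ^ k / 2 := by rw [hm, hL, hpp]; field_simp
  have hRL : R = L + 1 / 2 ^ k := by rw [hR, hL]; field_simp
  have hh : (0 : ℝ) < 1 / 2 ^ k := by positivity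
  have hL0 : 0 ≤ L := by positivity
  have hR1 : R ≤ 1 := by
    rw [hR, div_le_one hp]; exact_mod_cast hl
  have hcR : ((l + 1 : ℕ) : ℝ) / 2 ^ k = R := by rw [hR]; push_cast; rfl
  rw [hcR]
  have cell : ∀ u, L ≤ u → u < R → ⌊u * 2 ^ k⌋ = (l : ℤ) := fun u h1 h2 =>
    floor_cell (by simpa using h1) (by simpa using h2)
  have cell1 : ∀ u, L ≤ u → u < m → ⌊u * 2 ^ (k + 1)⌋ = (2 * l : ℤ) := fun u h1 h2 =>
    floor_cell (by convert h1 using 1; rw [hL, hpp]; push_cast; field_simp)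
      (by convert h2 using 1; push_cast; rfl)
  have cell2 : ∀ u, m ≤ u → u < R → ⌊u * 2 ^ (k + 1)⌋ = (2 * l + 1 : ℤ) := fun u h1 h2 =>
    floor_cell (by convert h1 using 1; push_cast; rfl)
      (by convert h2 using 1; rw [hR, hpp]; push_cast; field_simp; ring)
  have e2L : (2 * (l : ℝ)) / 2 ^ (k + 1) = L := by rw [hL, hpp]; field_simp
  have e2R : (2 * (l : ℝ) + 1 + 1) / 2 ^ (k + 1) = R := by rw [hR, hpp]; field_simp; ring
  have I1 : ∫ u in L..m, dyF x y k s u = ∫ u in L..m,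
      (2 ^ k * (u - L) * (2 * x m - x L - x R) - dyZ x k s) * (2 ^ k * (y R - y L)) := by
    apply intervalIntegral.integral_congr_ae
    filter_upwards [Measure.ae_ne volume m] with u hne hu
    rw [uIoc_of_le (by linarith)] at hu
    have hum : u < m := lt_of_le_of_ne hu.2 hne
    have c := cell u hu.1.le (by linarith)
    have c1 := cell1 u hu.1.le hum
    simp only [dyF, dySlope, smul_eq_mul]
    rw [show dyZ x k u = 2 ^ k * (u - L) * (2 * x m - x L - x R) by
      simp only [dyZ, dyadicApprox, smul_eq_mul, c, c1]
      push_cast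
      rw [e2L, ← hL, ← hR, ← hm, hpp]; ring, c]
    push_cast
    rfl
  have I2 : ∫ u in m..R, dyF x y k s u = ∫ u in m..R,
      ((1 - 2 ^ k * (u - L)) * (2 * x m - x L - x R) - dyZ x k s) * (2 ^ k * (y R - y L)) := by
    apply intervalIntegral.integral_congr_ae
    filter_upwards [Measure.ae_ne volume R] with u hne hu
    rw [uIoc_of_le (by linarith)] at hu
    have huR : u < R := lt_of_le_of_ne hu.2 hne
    have c := cell u (by linarith [hu.1]) huR
    have c1 := cell2 u hu.1.le huR
    simp only [dyF, dySlope, smul_eq_mul]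
    rw [show dyZ x k u = (1 - 2 ^ k * (u - L)) * (2 * x m - x L - x R) by
      simp only [dyZ, dyadicApprox, smul_eq_mul, c, c1]
      push_cast
      rw [e2R, ← hL, ← hR, ← hm, hpp]
      have : (2 * 2 ^ k) * (u - m) = 2 * 2 ^ k * (u - L) - 1 := by
        rw [hmL]; field_simp; ring
      rw [this]; ring, c]
    push_cast
    rfl
  rw [← intervalIntegral.integral_add_adjacent_intervals (b := m)
    (intervalIntegrable_dyF hx hy k s L m hL0 (by linarith) (by linarith) (by linarith))
    (intervalIntegrable_dyF hx hy k s m R (by linarith) (by linarith) (by linarith) hR1), I1, I2]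
  have key : ∀ A B α a b : ℝ, ∫ u in a..b, (A * u + B) = A * ((b ^ 2 - a ^ 2) / 2) + B * (b - a) := by
    intro A B α a b
    rw [intervalIntegral.integral_add (by apply Continuous.intervalIntegrable; fun_prop)
      (by apply Continuous.intervalIntegrable; fun_prop), intervalIntegral.integral_const_mul,
      integral_id, intervalIntegral.integral_const, smul_eq_mul]
    ring
  set D := 2 * x m - x L - x R
  set Z := dyZ x k s
  set Y := y R - y L
  rw [show (fun u => (2 ^ k * (u - L) * D - Z) * (2 ^ k * Y)) = fun u =>
    (2 ^ k * D * (2 ^ k * Y)) * u + (- 2 ^ k * L * D - Z) * (2 ^ k * Y) by ext u; ring, key _ _ 0,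
    show (fun u => ((1 - 2 ^ k * (u - L)) * D - Z) * (2 ^ k * Y)) = fun u =>
    (- 2 ^ k * D * (2 ^ k * Y)) * u + ((1 + 2 ^ k * L) * D - Z) * (2 ^ k * Y) by ext u; ring,
    key _ _ 0, hRL, hmL]
  field_simp
  ring

lemma sq_eLpNorm_two {α : Type*} [MeasurableSpace α] (μ : Measure α) (f : α → ℝ) :
    eLpNorm f 2 μ ^ 2 = ∫⁻ a, ‖f a‖ₑ ^ 2 ∂μ := by
  have := eLpNorm_nnreal_pow_eq_lintegral (f := f) (μ := μ) (p := 2) (by norm_num)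
  simpa using this

lemma sq_eLpNorm_two' {α : Type*} [MeasurableSpace α] (μ : Measure α) (f : α → ℝ)
    (hf : MemLp f 2 μ) :
    eLpNorm f 2 μ ^ 2 = ENNReal.ofReal (∫ a, f a ^ 2 ∂μ) := by
  rw [sq_eLpNorm_two, ofReal_integral_eq_lintegral_ofReal hf.integrable_sq
    (Eventually.of_forall fun _ => sq_nonneg _)]
  congr 1
  ext a
  rw [← sq_abs, ENNReal.ofReal_pow (abs_nonneg _), Real.enorm_eq_ofReal_abs]

lemma ennreal_le_of_sq_le {a b : ENNReal} (h : a ^ 2 ≤ b ^ 2) : a ≤ b :=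
  le_of_not_gt fun hlt => absurd h (not_le.2 (ENNReal.pow_lt_pow_left two_ne_zero hlt))

lemma eLpNorm_integral_le {Ω : Type*} [MeasurableSpace Ω] (P : Measure Ω) [IsProbabilityMeasure P]
    (f : ℝ × Ω → ℝ) (hf : Measurable f) (a b K : ℝ) (hab : a ≤ b) (hK : 0 ≤ K)
    (h : ∀ᵐ u : ℝ, u ∈ Ioc a b → eLpNorm (fun ω => f (u, ω)) 2 P ≤ ENNReal.ofReal K) :
    eLpNorm (fun ω => ∫ u in a..b, f (u, ω)) 2 P ≤ ENNReal.ofReal (K * (b - a)) := by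
  apply ennreal_le_of_sq_le
  rw [sq_eLpNorm_two]
  have hfe : Measurable (fun p : Ω × ℝ => ‖f (p.2, p.1)‖ₑ ^ 2) := by fun_prop
  have step : ∀ ω, ‖∫ u in a..b, f (u, ω)‖ₑ ^ 2 ≤
      ENNReal.ofReal (b - a) * ∫⁻ u in Ioc a b, ‖f (u, ω)‖ₑ ^ 2 := by
    intro ω
    have hm : Measurable (fun u => f (u, ω)) := by fun_prop
    rw [intervalIntegral.integral_of_le hab]
    have h1 := enorm_integral_le_lintegral_enorm (μ := volume.restrict (Ioc a b))
      (fun u => f (u, ω))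
    have h2 := eLpNorm_le_eLpNorm_mul_rpow_measure_univ (μ := volume.restrict (Ioc a b))
      (p := 1) (q := 2) (by norm_num) hm.aestronglyMeasurable
    rw [eLpNorm_one_eq_lintegral_enorm] at h2
    calc _ ≤ (eLpNorm (fun u => f (u, ω)) 2 (volume.restrict (Ioc a b)) *
          (volume.restrict (Ioc a b)) univ ^ (1 / (1 : ENNReal).toReal - 1 / (2 : ENNReal).toReal)) ^ 2 := by
          gcongr
          exact h1.trans h2
      _ = _ := by
          rw [mul_pow, sq_eLpNorm_two, mul_comm]
          congr 1
          rw [← ENNReal.rpow_natCast, ← ENNReal.rpow_mul]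
          norm_num
  calc _ ≤ ∫⁻ ω, ENNReal.ofReal (b - a) * (∫⁻ u in Ioc a b, ‖f (u, ω)‖ₑ ^ 2) ∂P :=
        lintegral_mono step
    _ = ENNReal.ofReal (b - a) * ∫⁻ ω, (∫⁻ u in Ioc a b, ‖f (u, ω)‖ₑ ^ 2) ∂P := by
        rw [lintegral_const_mul' _ _ ENNReal.ofReal_ne_top]
    _ = ENNReal.ofReal (b - a) * ∫⁻ u in Ioc a b, ∫⁻ ω, ‖f (u, ω)‖ₑ ^ 2 ∂P := by
        rw [lintegral_lintegral_swap]
        exact hfe.aemeasurable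
    _ ≤ ENNReal.ofReal (b - a) * ∫⁻ u in Ioc a b, (ENNReal.ofReal K) ^ 2 := by
        gcongr 1
        apply lintegral_mono_ae
        rw [ae_restrict_iff' measurableSet_Ioc]
        filter_upwards [h] with u hu hu'
        rw [← sq_eLpNorm_two P (fun ω => f (u, ω))]
        gcongr
        exact hu hu'
    _ = _ := by
        rw [lintegral_const, Measure.restrict_apply_univ, Real.volume_Ioc,
          ENNReal.ofReal_mul hK]
        ring

lemma eLpNorm_sum_indep {Ω : Type*} [MeasurableSpace Ω] (P : Measure Ω) [IsProbabilityMeasure P]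
    (X : ℕ → Ω → ℝ) (n : ℕ) (K : ℝ) (hK : 0 ≤ K) (hXm : ∀ l < n, AEStronglyMeasurable (X l) P)
    (hX : ∀ l < n, eLpNorm (X l) 2 P ≤ ENNReal.ofReal K)
    (h0 : ∀ l < n, ∫ ω, X l ω ∂P = 0)
    (hI : ∀ l < n, ∀ m < n, l < m → IndepFun (X l) (X m) P) :
    eLpNorm (fun ω => ∑ l ∈ Finset.range n, X l ω) 2 P ≤ ENNReal.ofReal (K * √n) := by
  have hL : ∀ l < n, MemLp (X l) 2 P := fun l hl =>
    ⟨hXm l hl, (hX l hl).trans_lt ENNReal.ofReal_lt_top⟩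
  have hS : MemLp (∑ l ∈ Finset.range n, X l) 2 P :=
    memLp_finsetSum' _ fun l hl => hL l (Finset.mem_range.1 hl)
  have e : (fun ω => ∑ l ∈ Finset.range n, X l ω) = ∑ l ∈ Finset.range n, X l := by
    ext ω; simp
  rw [e]
  apply ennreal_le_of_sq_le
  have hS0 : ∫ ω, (∑ l ∈ Finset.range n, X l) ω ∂P = 0 := by
    rw [← e, integral_finsetSum _ fun l hl =>
      (hL l (Finset.mem_range.1 hl)).integrable (by norm_num)]
    exact Finset.sum_eq_zero fun l hl => h0 l (Finset.mem_range.1 hl)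
  rw [sq_eLpNorm_two' P _ hS, ← variance_of_integral_eq_zero hS.aemeasurable hS0,
    IndepFun.variance_sum (fun l hl => hL l (Finset.mem_range.1 hl))]
  · rw [← ENNReal.ofReal_pow (by positivity), mul_pow, Real.sq_sqrt (by positivity)]
    apply ENNReal.ofReal_le_ofReal
    calc _ ≤ ∑ l ∈ Finset.range n, K ^ 2 := by
          apply Finset.sum_le_sum
          intro l hl
          have hl := Finset.mem_range.1 hl
          rw [variance_of_integral_eq_zero (hL l hl).aemeasurable (h0 l hl)]
          have := pow_le_pow_left₀ (by simp) (hX l hl) 2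
          rw [sq_eLpNorm_two' P _ (hL l hl), ← ENNReal.ofReal_pow hK] at this
          exact (ENNReal.ofReal_le_ofReal_iff (by positivity)).1 this
      _ = _ := by simp [mul_comm]
  · intro l hl m hm hlm
    simp only [Finset.coe_range, mem_Iio] at hl hm
    rcases lt_or_gt_of_ne hlm with h | h
    · exact hI l hl m hm h
    · exact (hI m hm l hl h).symm

lemma eLpNorm_mul_le {Ω : Type*} [MeasurableSpace Ω] (P : Measure Ω)
    (f g : Ω → ℝ) (hf : Measurable f) (hg : Measurable g) (A B : ℝ) (hA : 0 ≤ A)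
    (h1 : eLpNorm f 4 P ≤ ENNReal.ofReal A) (h2 : eLpNorm g 4 P ≤ ENNReal.ofReal B) :
    eLpNorm (fun ω => f ω * g ω) 2 P ≤ ENNReal.ofReal (A * B) := by
  have : ENNReal.HolderTriple 4 4 2 := ⟨by
    rw [← two_mul, show (4 : ENNReal) = 2 * 2 by norm_num, ENNReal.mul_inv (by simp) (by simp),
      ← mul_assoc, ENNReal.mul_inv_cancel (by simp) (by simp), one_mul]⟩
  have := eLpNorm_smul_le_mul_eLpNorm (p := 4) (q := 4) (r := 2) (μ := P)
    hg.aestronglyMeasurable hf.aestronglyMeasurable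
  rw [ENNReal.ofReal_mul hA]
  exact this.trans (mul_le_mul' h1 h2)

lemma eLpNorm_add_ofReal {Ω : Type*} [MeasurableSpace Ω] (P : Measure Ω) (p : ENNReal) (hp : 1 ≤ p)
    (f g : Ω → ℝ) (hf : Measurable f) (hg : Measurable g) (A B : ℝ) (hA : 0 ≤ A) (hB : 0 ≤ B)
    (h1 : eLpNorm f p P ≤ ENNReal.ofReal A) (h2 : eLpNorm g p P ≤ ENNReal.ofReal B) :
    eLpNorm (fun ω => f ω + g ω) p P ≤ ENNReal.ofReal (A + B) := by
  rw [ENNReal.ofReal_add hA hB]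
  exact (eLpNorm_add_le hf.aestronglyMeasurable hg.aestronglyMeasurable hp).trans
    (add_le_add h1 h2)

lemma eLpNorm_sub_ofReal {Ω : Type*} [MeasurableSpace Ω] (P : Measure Ω) (p : ENNReal) (hp : 1 ≤ p)
    (f g : Ω → ℝ) (hf : Measurable f) (hg : Measurable g) (A B : ℝ) (hA : 0 ≤ A) (hB : 0 ≤ B)
    (h1 : eLpNorm f p P ≤ ENNReal.ofReal A) (h2 : eLpNorm g p P ≤ ENNReal.ofReal B) :
    eLpNorm (fun ω => f ω - g ω) p P ≤ ENNReal.ofReal (A + B) := by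
  rw [ENNReal.ofReal_add hA hB]
  exact (eLpNorm_sub_le hf.aestronglyMeasurable hg.aestronglyMeasurable hp).trans
    (add_le_add h1 h2)

lemma eLpNorm_cmul_ofReal {Ω : Type*} [MeasurableSpace Ω] (P : Measure Ω) (p : ENNReal)
    (f : Ω → ℝ) (r A : ℝ) (hr : 0 ≤ r)
    (h1 : eLpNorm f p P ≤ ENNReal.ofReal A) :
    eLpNorm (fun ω => r * f ω) p P ≤ ENNReal.ofReal (r * A) := by
  have := eLpNorm_const_smul_le (c := r) (f := f) (p := p) (μ := P)
  rw [ENNReal.ofReal_mul hr]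
  refine this.trans ?_
  rw [Real.enorm_eq_ofReal hr]
  gcongr

/-- fourth moment increment bound -/
def IncBd {Ω : Type*} [MeasurableSpace Ω] (P : Measure Ω) (c : ℝ) (x : ℝ → Ω → ℝ) : Prop :=
  0 ≤ c ∧ Measurable (Function.uncurry x) ∧ ∀ s t, 0 ≤ s → s ≤ t → t ≤ 1 →
    eLpNorm (fun ω => x t ω - x s ω) 4 P ≤ ENNReal.ofReal (c * √(t - s))

lemma IncBd.meas {Ω : Type*} [MeasurableSpace Ω] {P : Measure Ω} {c : ℝ} {x : ℝ → Ω → ℝ}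
    (hx : IncBd P c x) (t : ℝ) : Measurable (x t) :=
  hx.2.1.of_uncurry_left

lemma IncBd.le {Ω : Type*} [MeasurableSpace Ω] {P : Measure Ω} {c : ℝ} {x : ℝ → Ω → ℝ}
    (hx : IncBd P c x) (s t h : ℝ) (hs : 0 ≤ s) (hst : s ≤ t) (ht : t ≤ 1) (hh : t - s ≤ h) :
    eLpNorm (fun ω => x t ω - x s ω) 4 P ≤ ENNReal.ofReal (c * √h) := by
  refine (hx.2.2 s t hs hst ht).trans (ENNReal.ofReal_le_ofReal ?_)
  have := hx.1
  gcongr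

lemma measurable_dyA {Ω : Type*} [MeasurableSpace Ω] {x : ℝ → Ω → ℝ}
    (hx : Measurable (Function.uncurry x)) (k : ℕ) (u : ℝ) :
    Measurable (fun ω => dyadicApprox (fun v => x v ω) k u) := by
  have hs : Measurable (fun ω : Ω => (u, ω)) := by fun_prop
  have h4 := (measurable_dyadicApprox hx k).comp hs
  simp only [Function.comp_def] at h4
  exact h4

lemma measurable_dyS {Ω : Type*} [MeasurableSpace Ω] {x : ℝ → Ω → ℝ}
    (hx : Measurable (Function.uncurry x)) (k : ℕ) (u : ℝ) :
    Measurable (fun ω => dySlope (fun v => x v ω) k u) := by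
  have hs : Measurable (fun ω : Ω => (u, ω)) := by fun_prop
  have h4 := (measurable_dySlope hx k).comp hs
  simp only [Function.comp_def] at h4
  exact h4

lemma measurable_dyZ {Ω : Type*} [MeasurableSpace Ω] {x : ℝ → Ω → ℝ}
    (hx : Measurable (Function.uncurry x)) (k : ℕ) (u : ℝ) :
    Measurable (fun ω => dyZ (fun v => x v ω) k u) :=
  (measurable_dyA hx (k + 1) u).sub (measurable_dyA hx k u)

lemma eLpNorm_approx {Ω : Type*} [MeasurableSpace Ω] {P : Measure Ω} {c : ℝ} {x : ℝ → Ω → ℝ}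
    (hx : IncBd P c x) (k : ℕ) (u : ℝ) (h0 : 0 ≤ u) (h1 : u ≤ 1) :
    eLpNorm (fun ω => dyadicApprox (fun v => x v ω) k u - x u ω) 4 P ≤
      ENNReal.ofReal (2 * c * √((2 ^ k)⁻¹)) := by
  have hp : (0 : ℝ) < 2 ^ k := by positivity
  have hc := hx.1
  rcases h1.eq_or_lt with rfl | hu
  · have : (fun ω => dyadicApprox (fun v => x v ω) k 1 - x 1 ω) = fun _ => 0 := by
      ext ω
      have hf : ⌊(1 : ℝ) * 2 ^ k⌋ = (2 ^ k : ℤ) := by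
        rw [Int.floor_eq_iff]; push_cast; constructor <;> linarith
      have h1' : (2 : ℝ) ^ k / 2 ^ k = 1 := by field_simp
      simp only [dyadicApprox, hf]
      push_cast
      rw [h1']
      simp
    rw [this]
    simp
  obtain ⟨a1, a2, a3, -, a5⟩ := floor_mem (k := k) h0 h1
  have a5 := a5 hu
  rw [show (fun ω => dyadicApprox (fun v => x v ω) k u - x u ω) = fun ω =>
    ((2 : ℝ) ^ k * (u - (⌊u * 2 ^ k⌋ : ℝ) / 2 ^ k)) *
      (x (((⌊u * 2 ^ k⌋ : ℝ) + 1) / 2 ^ k) ω - x ((⌊u * 2 ^ k⌋ : ℝ) / 2 ^ k) ω)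
      - (x u ω - x ((⌊u * 2 ^ k⌋ : ℝ) / 2 ^ k) ω) by
    ext ω; simp only [dyadicApprox, smul_eq_mul]; ring]
  have hRL : ((⌊u * 2 ^ k⌋ : ℝ) + 1) / 2 ^ k = (⌊u * 2 ^ k⌋ : ℝ) / 2 ^ k + (2 ^ k)⁻¹ := by
    field_simp
  generalize (⌊u * 2 ^ k⌋ : ℝ) / 2 ^ k = L at *
  generalize ((⌊u * 2 ^ k⌋ : ℝ) + 1) / 2 ^ k = R at *
  have ht0 : 0 ≤ (2 : ℝ) ^ k * (u - L) := by
    apply mul_nonneg hp.le; linarith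
  have ht1 : (2 : ℝ) ^ k * (u - L) ≤ 1 := by
    calc _ ≤ (2 : ℝ) ^ k * (2 ^ k)⁻¹ := by gcongr; linarith
      _ = 1 := by field_simp
  have m1 := hx.meas L
  have m2 := hx.meas R
  have m3 := hx.meas u
  refine (eLpNorm_sub_ofReal P 4 (by norm_num) _ _ (by fun_prop) (by fun_prop)
    ((2 : ℝ) ^ k * (u - L) * (c * √((2 ^ k)⁻¹))) (c * √((2 ^ k)⁻¹)) (by positivity)
    (by positivity) (eLpNorm_cmul_ofReal P 4 _ _ _ ht0 (hx.le L R _ a1 (by linarith) a5 (by linarith)))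
    (hx.le L u _ a1 a2 h1 (by linarith))).trans (ENNReal.ofReal_le_ofReal ?_)
  have : 0 ≤ c * √((2 ^ k)⁻¹) := by positivity
  nlinarith

lemma eLpNorm_dyZ {Ω : Type*} [MeasurableSpace Ω] {P : Measure Ω} {c : ℝ} {x : ℝ → Ω → ℝ}
    (hx : IncBd P c x) (k : ℕ) (u : ℝ) (h0 : 0 ≤ u) (h1 : u ≤ 1) :
    eLpNorm (fun ω => dyZ (fun v => x v ω) k u) 4 P ≤
      ENNReal.ofReal (4 * c * √((2 ^ k)⁻¹)) := by
  have hc := hx.1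
  have e1 := eLpNorm_approx hx k u h0 h1
  have e2 := eLpNorm_approx hx (k + 1) u h0 h1
  have hm := hx.meas u
  have m1 := measurable_dyA hx.2.1 k u
  have m2 := measurable_dyA hx.2.1 (k + 1) u
  have := eLpNorm_sub_ofReal P 4 (by norm_num) _ _ (m2.sub hm) (m1.sub hm) _ _ (by positivity)
    (by positivity) e2 e1
  rw [show (fun ω => dyZ (fun v => x v ω) k u) = fun ω =>
    (dyadicApprox (fun v => x v ω) (k + 1) u - x u ω) -
     (dyadicApprox (fun v => x v ω) k u - x u ω) by ext ω; simp only [dyZ]; ring]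
  refine this.trans (ENNReal.ofReal_le_ofReal ?_)
  have : √(((2 : ℝ) ^ (k + 1))⁻¹) ≤ √((2 ^ k)⁻¹) := by
    gcongr
    · norm_num
    · omega
  nlinarith

lemma eLpNorm_slope {Ω : Type*} [MeasurableSpace Ω] {P : Measure Ω} {c : ℝ} {x : ℝ → Ω → ℝ}
    (hx : IncBd P c x) (k : ℕ) (u : ℝ) (h0 : 0 ≤ u) (h1 : u < 1) :
    eLpNorm (fun ω => dySlope (fun v => x v ω) k u) 4 P ≤
      ENNReal.ofReal (2 ^ k * (c * √((2 ^ k)⁻¹))) := by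
  obtain ⟨a1, a2, a3, -, a5⟩ := floor_mem (k := k) h0 h1.le
  have a5 := a5 h1
  have hRL : ((⌊u * 2 ^ k⌋ : ℝ) + 1) / 2 ^ k = (⌊u * 2 ^ k⌋ : ℝ) / 2 ^ k + (2 ^ k)⁻¹ := by
    field_simp
  simp only [dySlope, smul_eq_mul]
  exact eLpNorm_cmul_ofReal P 4 _ _ _ (by positivity)
    (hx.le _ _ _ a1 (by linarith) a5 (by linarith))

lemma eLpNorm_dyF {Ω : Type*} [MeasurableSpace Ω] {P : Measure Ω} {c : ℝ} {x y : ℝ → Ω → ℝ}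
    (hx : IncBd P c x) (hy : IncBd P c y) (k : ℕ) (s u : ℝ) (hs0 : 0 ≤ s) (hs1 : s ≤ 1)
    (h0 : 0 ≤ u) (h1 : u < 1) :
    eLpNorm (fun ω => dyF (fun v => x v ω) (fun v => y v ω) k s u) 2 P ≤
      ENNReal.ofReal (8 * c ^ 2) := by
  have hc := hx.1
  have e1 := eLpNorm_sub_ofReal P 4 (by norm_num) _ _ (measurable_dyZ hx.2.1 k u)
    (measurable_dyZ hx.2.1 k s) _ _ (by positivity) (by positivity)
    (eLpNorm_dyZ hx k u h0 h1.le) (eLpNorm_dyZ hx k s hs0 hs1)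
  have e2 := eLpNorm_mul_le P _ _ ((measurable_dyZ hx.2.1 k u).sub
    (measurable_dyZ hx.2.1 k s)) (measurable_dyS hy.2.1 k u) _ _ (by positivity) e1
    (eLpNorm_slope hy k u h0 h1)
  refine e2.trans (ENNReal.ofReal_le_ofReal (le_of_eq ?_))
  have : √(((2 : ℝ) ^ k)⁻¹) ^ 2 = (2 ^ k)⁻¹ := Real.sq_sqrt (by positivity)
  calc _ = 8 * c ^ 2 * (2 ^ k * √(((2 : ℝ) ^ k)⁻¹) ^ 2) := by ring
    _ = _ := by rw [this]; field_simp

lemma lemmaA {Ω : Type*} [MeasurableSpace Ω] {P : Measure Ω} [IsProbabilityMeasure P] {c : ℝ}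
    {x y : ℝ → Ω → ℝ}
    (hx : IncBd P c x) (hy : IncBd P c y) (k : ℕ) (s a b : ℝ) (hs0 : 0 ≤ s) (hs1 : s ≤ 1)
    (h0 : 0 ≤ a) (hab : a ≤ b) (h1 : b ≤ 1) :
    eLpNorm (fun ω => ∫ u in a..b, dyF (fun v => x v ω) (fun v => y v ω) k s u) 2 P ≤
      ENNReal.ofReal (8 * c ^ 2 * (b - a)) := by
  refine eLpNorm_integral_le P (fun p : ℝ × Ω => dyF (fun u => x u p.2) (fun u => y u p.2) k s p.1)
    (measurable_dyF hx.2.1 hy.2.1 k s) a b _ hab (by positivity) ?_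
  filter_upwards [Measure.ae_ne volume 1] with u hne hu
  exact eLpNorm_dyF hx hy k s u hs0 hs1 (by linarith [hu.1])
    (lt_of_le_of_ne (hu.2.trans h1) hne)

lemma measurable_G {Ω : Type*} [MeasurableSpace Ω] {x y : ℝ → Ω → ℝ}
    (hx : Measurable (Function.uncurry x)) (hy : Measurable (Function.uncurry y)) (k : ℕ)
    (s a b : ℝ) :
    Measurable (fun ω => ∫ u in a..b, dyF (fun v => x v ω) (fun v => y v ω) k s u) := by
  have h := (measurable_dyF hx hy k s).stronglyMeasurable
  simp only [intervalIntegral]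
  exact (h.integral_prod_left (μ := volume.restrict (Ioc a b))).measurable.sub
    (h.integral_prod_left (μ := volume.restrict (Ioc b a))).measurable

/-- cell contribution -/
noncomputable def cellX {Ω : Type*} (x y : ℝ → Ω → ℝ) (k l : ℕ) (ω : Ω) : ℝ :=
  (2 * x ((2 * l + 1) / 2 ^ (k + 1)) ω - x (l / 2 ^ k) ω - x ((l + 1) / 2 ^ k) ω) / 4
        * (y ((l + 1) / 2 ^ k) ω - y (l / 2 ^ k) ω)

lemma cell_times {k l : ℕ} (hl : l < 2 ^ k) :
    0 ≤ (l : ℝ) / 2 ^ k ∧ (2 * (l : ℝ) + 1) / 2 ^ (k + 1) = (l : ℝ) / 2 ^ k + (2 ^ k)⁻¹ / 2 ∧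
    ((l : ℝ) + 1) / 2 ^ k = (l : ℝ) / 2 ^ k + (2 ^ k)⁻¹ ∧ ((l : ℝ) + 1) / 2 ^ k ≤ 1 := by
  have hp : (0 : ℝ) < 2 ^ k := by positivity
  have hpp : (2 : ℝ) ^ (k + 1) = 2 * 2 ^ k := by ring
  refine ⟨by positivity, ?_, ?_, ?_⟩
  · rw [hpp]; field_simp
  · field_simp
  · rw [div_le_one hp]; exact_mod_cast hl

lemma measurable_cellX {Ω : Type*} [MeasurableSpace Ω] {P : Measure Ω} {c : ℝ} {x y : ℝ → Ω → ℝ}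
    (hx : IncBd P c x) (hy : IncBd P c y) (k l : ℕ) : Measurable (cellX x y k l) := by
  have h1 := hx.meas
  have h2 := hy.meas
  unfold cellX
  fun_prop

lemma eLpNorm_cellX {Ω : Type*} [MeasurableSpace Ω] {P : Measure Ω} {c : ℝ} {x y : ℝ → Ω → ℝ}
    (hx : IncBd P c x) (hy : IncBd P c y) (k l : ℕ) (hl : l < 2 ^ k) :
    eLpNorm (cellX x y k l) 2 P ≤ ENNReal.ofReal (c ^ 2 * (2 ^ k)⁻¹) := by
  have hc := hx.1
  have h1 := hx.meas
  have h2 := hy.meas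
  obtain ⟨a1, a2, a3, a4⟩ := cell_times hl
  have hh : (0 : ℝ) < (2 ^ k)⁻¹ := by positivity
  unfold cellX
  generalize (l : ℝ) / 2 ^ k = L at *
  generalize ((l : ℝ) + 1) / 2 ^ k = R at *
  generalize (2 * (l : ℝ) + 1) / 2 ^ (k + 1) = m at *
  have e1 := hx.le L m (2 ^ k)⁻¹ a1 (by linarith) (by linarith) (by linarith)
  have e2 := hx.le m R (2 ^ k)⁻¹ (by linarith) (by linarith) (by linarith) (by linarith)
  have e3 := hy.le L R (2 ^ k)⁻¹ a1 (by linarith) (by linarith) (by linarith)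
  have e4 := eLpNorm_cmul_ofReal P 4 _ (1 / 4) _ (by norm_num)
    (eLpNorm_sub_ofReal P 4 (by norm_num) _ _ (by fun_prop) (by fun_prop) _ _
    (by positivity) (by positivity) e1 e2)
  have e5 := eLpNorm_mul_le P _ _ (by fun_prop) (by fun_prop) _ _ (by positivity) e4 e3
  rw [show (fun ω => (2 * x m ω - x L ω - x R ω) / 4 * (y R ω - y L ω)) = fun ω =>
    1 / 4 * (x m ω - x L ω - (x R ω - x m ω)) * (y R ω - y L ω) by ext ω; ring]
  refine e5.trans (ENNReal.ofReal_le_ofReal ?_)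
  have : √(((2 : ℝ) ^ k)⁻¹) ^ 2 = (2 ^ k)⁻¹ := Real.sq_sqrt (by positivity)
  calc _ = c ^ 2 * √(((2 : ℝ) ^ k)⁻¹) ^ 2 / 2 := by ring
    _ ≤ _ := by rw [this]; have : 0 ≤ c ^ 2 * (2 ^ k)⁻¹ := by positivity
                linarith

lemma lemmaG {Ω : Type*} [MeasurableSpace Ω] {P : Measure Ω} [IsProbabilityMeasure P] {c : ℝ}
    {x y : ℝ → Ω → ℝ}
    (hx : IncBd P c x) (hy : IncBd P c y) (hxc : ∀ ω, Continuous fun t => x t ω)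
    (hyc : ∀ ω, Continuous fun t => y t ω) (k : ℕ)
    (h0 : ∀ l < 2 ^ k, ∫ ω, cellX x y k l ω ∂P = 0)
    (hI : ∀ l < 2 ^ k, ∀ m < 2 ^ k, l < m → IndepFun (cellX x y k l) (cellX x y k m) P)
    (s t : ℝ) (hs0 : 0 ≤ s) (hs1 : s ≤ 1) (ht0 : 0 ≤ t) (ht1 : t ≤ 1) :
    eLpNorm (fun ω => ∫ u in 0..t, dyF (fun v => x v ω) (fun v => y v ω) k s u) 2 P ≤
      ENNReal.ofReal (13 * c ^ 2 * √((2 ^ k)⁻¹)) := by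
  have hc := hx.1
  have hp : (0 : ℝ) < 2 ^ k := by positivity
  have hp1 : (1 : ℝ) ≤ 2 ^ k := one_le_pow₀ (by norm_num)
  have hh1 : ((2 : ℝ) ^ k)⁻¹ ≤ 1 := inv_le_one_of_one_le₀ hp1
  have hh : (0 : ℝ) < (2 ^ k)⁻¹ := by positivity
  have hsq : √(((2 : ℝ) ^ k)⁻¹) ^ 2 = (2 ^ k)⁻¹ := Real.sq_sqrt (by positivity)
  set r := √(((2 : ℝ) ^ k)⁻¹) with hr
  have hr0 : 0 ≤ r := Real.sqrt_nonneg _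
  have hr1 : r ≤ 1 := Real.sqrt_le_one.2 hh1
  set q := ⌊t * 2 ^ k⌋₊ with hq
  have hqt : (q : ℝ) / 2 ^ k ≤ t := by
    rw [div_le_iff₀ hp]; exact Nat.floor_le (by positivity)
  have hqt' : t < (q : ℝ) / 2 ^ k + (2 ^ k)⁻¹ := by
    have := Nat.lt_floor_add_one (t * 2 ^ k)
    rw [← hq, ← lt_div_iff₀ hp, add_div, one_div] at this
    exact this
  have hq0 : (0 : ℝ) ≤ (q : ℝ) / 2 ^ k := by positivity
  have hqn : q ≤ 2 ^ k := by
    have : (q : ℝ) ≤ 2 ^ k := by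
      rw [div_le_iff₀ hp] at hqt; nlinarith
    exact_mod_cast this
  have split : (fun ω => ∫ u in 0..t, dyF (fun v => x v ω) (fun v => y v ω) k s u) = fun ω =>
      ((∑ l ∈ Finset.range q, cellX x y k l ω) - dyZ (fun v => x v ω) k s *
        (y ((q : ℝ) / 2 ^ k) ω - y 0 ω)) +
      ∫ u in ((q : ℝ) / 2 ^ k)..t, dyF (fun v => x v ω) (fun v => y v ω) k s u := by
    ext ω
    have hii : ∀ a b : ℝ, 0 ≤ a → a ≤ 1 → 0 ≤ b → b ≤ 1 →
        IntervalIntegrable (dyF (fun v => x v ω) (fun v => y v ω) k s) volume a b :=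
      fun a b => intervalIntegrable_dyF (hxc ω) (hyc ω) k s a b
    rw [← intervalIntegral.integral_add_adjacent_intervals (b := (q : ℝ) / 2 ^ k)
      (hii _ _ le_rfl zero_le_one hq0 (by linarith)) (hii _ _ hq0 (by linarith) ht0 ht1)]
    congr 1
    have hadj := intervalIntegral.sum_integral_adjacent_intervals
      (f := dyF (fun v => x v ω) (fun v => y v ω) k s) (μ := volume)
      (a := fun l : ℕ => (l : ℝ) / 2 ^ k) (n := q) (fun l hl => by
        have hl' : l < 2 ^ k := by omega
        obtain ⟨a1, a2, a3, a4⟩ := cell_times hl'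
        apply hii
        · exact a1
        · linarith
        · positivity
        · push_cast; exact a4)
    simp only [Nat.cast_zero, zero_div] at hadj
    rw [← hadj]
    have htel := Finset.sum_range_sub (fun l : ℕ => y ((l : ℝ) / 2 ^ k) ω) q
    simp only [Nat.cast_zero, zero_div] at htel
    rw [← htel, Finset.mul_sum, ← Finset.sum_sub_distrib]
    apply Finset.sum_congr rfl
    intro l hl
    rw [Finset.mem_range] at hl
    rw [integral_cell _ _ (hxc ω) (hyc ω) k s l (by omega)]
    push_cast
    rfl
  rw [split]
  have mX := fun l => measurable_cellX hx hy k l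
  have mZ := measurable_dyZ hx.2.1 k s
  have my := hy.meas
  have mG := measurable_G hx.2.1 hy.2.1 k s ((q : ℝ) / 2 ^ k) t
  have b1 := eLpNorm_sum_indep P (cellX x y k) q (c ^ 2 * (2 ^ k)⁻¹) (by positivity)
    (fun l _ => (mX l).aestronglyMeasurable)
    (fun l hl => eLpNorm_cellX hx hy k l (by omega)) (fun l hl => h0 l (by omega))
    (fun l hl m hm => hI l (by omega) m (by omega))
  have b2 := eLpNorm_mul_le P _ _ mZ ((my ((q : ℝ) / 2 ^ k)).sub (my 0)) _ _ (by positivity)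
    (eLpNorm_dyZ hx k s hs0 hs1) (hy.le 0 ((q : ℝ) / 2 ^ k) 1 le_rfl hq0 (by linarith)
      (by linarith))
  have b3 := lemmaA hx hy k s ((q : ℝ) / 2 ^ k) t hs0 hs1 hq0 hqt ht1
  have mS : Measurable (fun ω => ∑ l ∈ Finset.range q, cellX x y k l ω) :=
    Finset.measurable_fun_sum _ fun l _ => mX l
  have b4 := eLpNorm_sub_ofReal P 2 (by norm_num) _ _ mS (mZ.mul ((my _).sub (my _))) _ _
    (by positivity) (by positivity) b1 b2
  have b5 := eLpNorm_add_ofReal P 2 (by norm_num) _ _ (mS.sub (mZ.mul ((my _).sub (my _)))) mG _ _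
    (by positivity) (mul_nonneg (by positivity) (by linarith)) b4 b3
  refine b5.trans (ENNReal.ofReal_le_ofReal ?_)
  rw [← hr, Real.sqrt_one]
  have f1 : (2 ^ k)⁻¹ * √(q : ℝ) ≤ r := by
    have : √(q : ℝ) ≤ √(2 ^ k) := by
      apply Real.sqrt_le_sqrt; exact_mod_cast hqn
    have h2 : r * √(2 ^ k) = 1 := by
      rw [hr, ← Real.sqrt_mul (by positivity), inv_mul_cancel₀ hp.ne', Real.sqrt_one]
    calc _ ≤ r ^ 2 * √(2 ^ k) := by rw [hsq]; gcongr
      _ = r * (r * √(2 ^ k)) := by ring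
      _ = r := by rw [h2, mul_one]
  have f2 : t - q / 2 ^ k ≤ r := by nlinarith
  have hc2 : 0 ≤ c ^ 2 := by positivity
  nlinarith [mul_le_mul_of_nonneg_left f1 hc2, mul_le_mul_of_nonneg_left f2 hc2]

lemma eLpNorm_gauss (v : NNReal) :
    eLpNorm id 4 (gaussianReal 0 v) =
      ENNReal.ofReal ((eLpNorm id 4 (gaussianReal 0 1)).toReal * √(v : ℝ)) := by
  have hfin : eLpNorm id 4 (gaussianReal 0 1) ≠ ⊤ :=
    (memLp_id_gaussianReal' (μ := 0) (v := 1) 4 (by simp)).eLpNorm_lt_top.ne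
  have h := gaussianReal_map_const_mul (μ := 0) (v := 1) (√(v : ℝ))
  have hv : gaussianReal (√(v : ℝ) * 0) (NNReal.mk (√(v : ℝ) ^ 2) (sq_nonneg _) * 1)
      = gaussianReal 0 v := by
    congr 1
    · simp
    · ext; simp
  rw [hv] at h
  rw [← h, eLpNorm_map_measure aestronglyMeasurable_id (by fun_prop)]
  have h2 : (id ∘ fun x : ℝ => √(v : ℝ) * x) = √(v : ℝ) • (id : ℝ → ℝ) := by
    ext x; simp
  rw [h2, eLpNorm_const_smul, ENNReal.ofReal_mul ENNReal.toReal_nonneg,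
    ENNReal.ofReal_toReal hfin, Real.enorm_eq_ofReal (Real.sqrt_nonneg _), mul_comm]

lemma incBd_of_bm {Ω : Type*} [MeasurableSpace Ω] {P : Measure Ω} {d : ℕ}
    {w : ℝ → Ω → EuclideanSpace ℝ (Fin d)} (hw : IsBrownianMotion P d w) (i : Fin d) :
    IncBd P (eLpNorm id 4 (gaussianReal 0 1)).toReal (fun t ω => w t ω i) := by
  obtain ⟨hP, hm, hc, h0, hI, hg⟩ := hw
  refine ⟨ENNReal.toReal_nonneg, ?_, ?_⟩
  · apply measurable_uncurry_of_continuous_of_measurable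
    · intro ω
      have := hc ω
      fun_prop
    · intro t
      have := hm t
      fun_prop
  · intro s t hs hst ht
    have := (hg s t hs hst ht).2 i
    have h2 := eLpNorm_gauss (Real.toNNReal (t - s))
    have m1 := hm t
    have m2 := hm s
    rw [← this, eLpNorm_map_measure aestronglyMeasurable_id (by fun_prop),
      Real.coe_toNNReal _ (by linarith)] at h2
    exact h2.le

lemma integrable_mul_inc {Ω : Type*} [MeasurableSpace Ω] {P : Measure Ω} [IsProbabilityMeasure P]
    {c : ℝ} {x y : ℝ → Ω → ℝ} (hx : IncBd P c x) (hy : IncBd P c y) (s t s' t' : ℝ)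
    (hs : 0 ≤ s) (hst : s ≤ t) (ht : t ≤ 1) (hs' : 0 ≤ s') (hst' : s' ≤ t') (ht' : t' ≤ 1) :
    Integrable (fun ω => (x t ω - x s ω) * (y t' ω - y s' ω)) P := by
  have mx := hx.meas
  have my := hy.meas
  have hc := hx.1
  have := eLpNorm_mul_le P _ _ ((mx t).sub (mx s)) ((my t').sub (my s')) _ _ (by positivity)
    (hx.2.2 s t hs hst ht) (hy.2.2 s' t' hs' hst' ht')
  have hM : MemLp (fun ω => (x t ω - x s ω) * (y t' ω - y s' ω)) 2 P :=
    ⟨(((mx t).sub (mx s)).mul ((my t').sub (my s'))).aestronglyMeasurable,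
      this.trans_lt ENNReal.ofReal_lt_top⟩
  exact hM.integrable (by norm_num)

lemma bm_mean {Ω : Type*} [MeasurableSpace Ω] {P : Measure Ω} {d : ℕ}
    {w : ℝ → Ω → EuclideanSpace ℝ (Fin d)} (hw : IsBrownianMotion P d w) (i : Fin d)
    (s t : ℝ) (hs : 0 ≤ s) (hst : s ≤ t) (ht : t ≤ 1) :
    ∫ ω, (w t ω i - w s ω i) ∂P = 0 := by
  obtain ⟨hP, hm, hc, h0, hI, hg⟩ := hw
  have := (hg s t hs hst ht).2 i
  have m1 := hm t
  have m2 := hm s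
  have e := integral_id_gaussianReal (μ := 0) (v := Real.toNNReal (t - s))
  rw [← this, integral_map (by fun_prop) (by fun_prop)] at e
  exact e

lemma bm_cov {Ω : Type*} [MeasurableSpace Ω] {P : Measure Ω} {d : ℕ}
    {w : ℝ → Ω → EuclideanSpace ℝ (Fin d)} (hw : IsBrownianMotion P d w) (i j : Fin d)
    (s t : ℝ) (hs : 0 ≤ s) (hst : s ≤ t) (ht : t ≤ 1) :
    ∫ ω, (w t ω i - w s ω i) * (w t ω j - w s ω j) ∂P =
      if i = j then ∫ x, x * x ∂(gaussianReal 0 (Real.toNNReal (t - s))) else 0 := by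
  have hmean := bm_mean hw i s t hs hst ht
  obtain ⟨hP, hm, hc, h0, hI, hg⟩ := hw
  have m1 := hm t
  have m2 := hm s
  split_ifs with hij
  · subst hij
    rw [← (hg s t hs hst ht).2 i, integral_map (by fun_prop) (by fun_prop)]
    rfl
  · have hind := (hg s t hs hst ht).1.indepFun hij
    have := hind.integral_fun_mul_eq_mul_integral
      (Measurable.aestronglyMeasurable (by fun_prop)) (Measurable.aestronglyMeasurable (by fun_prop))
    simp only [PiLp.sub_apply] at this
    rw [this, hmean, zero_mul]

lemma bm_cross {Ω : Type*} [MeasurableSpace Ω] {P : Measure Ω} {d : ℕ}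
    {w : ℝ → Ω → EuclideanSpace ℝ (Fin d)} (hw : IsBrownianMotion P d w) (i j : Fin d)
    (s m t : ℝ) (hs : 0 ≤ s) (hsm : s ≤ m) (hmt : m ≤ t) (ht : t ≤ 1) :
    ∫ ω, (w m ω i - w s ω i) * (w t ω j - w m ω j) ∂P = 0 := by
  have hmean := bm_mean hw i s m hs hsm (by linarith)
  obtain ⟨hP, hm, hc, h0, hI, hg⟩ := hw
  have h := hI 2 ![s, m, t] (by
      rw [Fin.monotone_iff_le_succ]; intro i; fin_cases i <;> simpa) (by
      intro i; fin_cases i <;> simp <;> constructor <;> linarith)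
  have h := h.indepFun (i := 0) (j := 1) (by simp)
  have m1 := hm t
  have m2 := hm s
  have m3 := hm m
  have h := h.comp (φ := fun v : EuclideanSpace ℝ (Fin d) => v i)
    (ψ := fun v : EuclideanSpace ℝ (Fin d) => v j) (by fun_prop) (by fun_prop)
  have := h.integral_fun_mul_eq_mul_integral
      (Measurable.aestronglyMeasurable (by simp; fun_prop))
      (Measurable.aestronglyMeasurable (by simp; fun_prop))
  simp [Function.comp_def] at this
  rw [this, hmean, zero_mul]

lemma bm_cell_mean {Ω : Type*} [MeasurableSpace Ω] {P : Measure Ω} {d : ℕ}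
    {w : ℝ → Ω → EuclideanSpace ℝ (Fin d)} (hw : IsBrownianMotion P d w) (i j : Fin d)
    (k l : ℕ) (hl : l < 2 ^ k) :
    ∫ ω, cellX (fun t ω => w t ω i) (fun t ω => w t ω j) k l ω ∂P = 0 := by
  obtain ⟨a1, a2, a3, a4⟩ := cell_times hl
  have hh : (0 : ℝ) < (2 ^ k)⁻¹ := by positivity
  have hP := hw.1
  have hi := incBd_of_bm hw i
  have hj := incBd_of_bm hw j
  unfold cellX
  generalize (l : ℝ) / 2 ^ k = L at *
  generalize ((l : ℝ) + 1) / 2 ^ k = R at *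
  generalize (2 * (l : ℝ) + 1) / 2 ^ (k + 1) = m at *
  have hLm : L ≤ m := by linarith
  have hmR : m ≤ R := by linarith
  have hm1 : m ≤ 1 := by linarith
  have hm0 : 0 ≤ m := by linarith
  have i1 := integrable_mul_inc hi hj L m L m a1 hLm hm1 a1 hLm hm1
  have i2 := integrable_mul_inc hi hj L m m R a1 hLm hm1 hm0 hmR a4
  have i3 := integrable_mul_inc hj hi L m m R a1 hLm hm1 hm0 hmR a4
  have i4 := integrable_mul_inc hi hj m R m R hm0 hmR a4 hm0 hmR a4
  rw [show (fun ω => (2 * w m ω i - w L ω i - w R ω i) / 4 * (w R ω j - w L ω j)) = fun ω =>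
    (((w m ω i - w L ω i) * (w m ω j - w L ω j) + (w m ω i - w L ω i) * (w R ω j - w m ω j))
     - ((w m ω j - w L ω j) * (w R ω i - w m ω i) + (w R ω i - w m ω i) * (w R ω j - w m ω j))) / 4
     by ext ω; ring]
  rw [integral_div, integral_sub (by exact i1.add i2) (by exact i3.add i4), integral_add i1 i2, integral_add i3 i4,
    bm_cross hw i j L m R a1 hLm hmR a4, bm_cross hw j i L m R a1 hLm hmR a4,
    bm_cov hw i j L m a1 hLm hm1, bm_cov hw i j m R hm0 hmR a4,
    show R - m = m - L by linarith]
  simp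

lemma bm_cell_indep {Ω : Type*} [MeasurableSpace Ω] {P : Measure Ω} {d : ℕ}
    {w : ℝ → Ω → EuclideanSpace ℝ (Fin d)} (hw : IsBrownianMotion P d w) (i j : Fin d)
    (k l l' : ℕ) (hl : l < 2 ^ k) (hl' : l' < 2 ^ k) (hll : l < l') :
    IndepFun (cellX (fun t ω => w t ω i) (fun t ω => w t ω j) k l)
      (cellX (fun t ω => w t ω i) (fun t ω => w t ω j) k l') P := by
  obtain ⟨a1, a2, a3, a4⟩ := cell_times hl
  obtain ⟨b1, b2, b3, b4⟩ := cell_times hl'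
  have hh : (0 : ℝ) < (2 ^ k)⁻¹ := by positivity
  have hRL : ((l : ℝ) + 1) / 2 ^ k ≤ (l' : ℝ) / 2 ^ k := by
    gcongr; exact_mod_cast hll
  obtain ⟨hP, hm, hc, h0, hI, hg⟩ := hw
  unfold cellX
  generalize (l : ℝ) / 2 ^ k = L at *
  generalize ((l : ℝ) + 1) / 2 ^ k = R at *
  generalize (2 * (l : ℝ) + 1) / 2 ^ (k + 1) = m at *
  generalize (l' : ℝ) / 2 ^ k = L' at *
  generalize ((l' : ℝ) + 1) / 2 ^ k = R' at *
  generalize (2 * (l' : ℝ) + 1) / 2 ^ (k + 1) = m' at *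
  have h := hI 5 ![L, m, R, L', m', R'] (by
      rw [Fin.monotone_iff_le_succ]; intro i; fin_cases i <;> simp <;> linarith) (by
      intro i; fin_cases i <;> simp <;> constructor <;> linarith)
  have h := h.indepFun_prodMk_prodMk (fun i => (hm _).sub (hm _)) 0 1 3 4 (by decide) (by decide)
    (by decide) (by decide)
  have hφ : Measurable (fun p : EuclideanSpace ℝ (Fin d) × EuclideanSpace ℝ (Fin d) =>
    (p.1 i - p.2 i) / 4 * (p.1 j + p.2 j)) := by fun_prop
  have h := h.comp hφ hφ
  convert h using 1
  · ext ω
    simp [Function.comp_def]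
    left; ring
  · ext ω
    simp [Function.comp_def]
    left; ring

lemma bm_final {Ω : Type*} [MeasurableSpace Ω] {P : Measure Ω} {d : ℕ}
    {w : ℝ → Ω → EuclideanSpace ℝ (Fin d)} (hw : IsBrownianMotion P d w) (i j : Fin d)
    (c : ℝ) (hc : c = (eLpNorm id 4 (gaussianReal 0 1)).toReal)
    (k : ℕ) (s t : ℝ) (hs : 0 ≤ s) (hst : s ≤ t) (ht : t ≤ 1) :
    ∫⁻ ω, ENNReal.ofReal
      ((∫ u in s..t, dyF (fun v => w v ω i) (fun v => w v ω j) k s u) ^ 2) ∂P ≤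
      ENNReal.ofReal ((26 * c ^ 2) ^ 2 * min (((2 : ℝ) ^ k)⁻¹) ((t - s) ^ 2)) := by
  have hP := hw.1
  have hi := incBd_of_bm hw i
  have hj := incBd_of_bm hw j
  rw [← hc] at hi hj
  have hci : ∀ ω, Continuous fun t => w t ω i := fun ω => by
    have := hw.2.2.1 ω
    fun_prop
  have hcj : ∀ ω, Continuous fun t => w t ω j := fun ω => by
    have := hw.2.2.1 ω
    fun_prop
  have key : ∀ f : Ω → ℝ, ∫⁻ ω, ENNReal.ofReal (f ω ^ 2) ∂P = eLpNorm f 2 P ^ 2 := by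
    intro f
    rw [sq_eLpNorm_two]
    congr 1
    ext a
    rw [← sq_abs, ENNReal.ofReal_pow (abs_nonneg _), Real.enorm_eq_ofReal_abs]
  rw [key]
  rcases min_cases (((2 : ℝ) ^ k)⁻¹) ((t - s) ^ 2) with ⟨h, -⟩ | ⟨h, -⟩ <;> rw [h]
  · have g := fun t h1 h2 => lemmaG hi hj hci hcj k (fun l hl => bm_cell_mean hw i j k l hl)
      (fun l hl m hm hlm => bm_cell_indep hw i j k l m hl hm hlm) s t hs (by linarith) h1 h2
    have hm := fun t => measurable_G hi.2.1 hj.2.1 k s 0 t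
    have := eLpNorm_sub_ofReal P 2 (by norm_num) _ _ (hm t) (hm s) _ _ (by positivity)
      (by positivity) (g t (by linarith) ht) (g s hs (by linarith))
    have e : (fun ω => ∫ u in s..t, dyF (fun v => w v ω i) (fun v => w v ω j) k s u) = fun ω =>
        (∫ u in 0..t, dyF (fun v => w v ω i) (fun v => w v ω j) k s u) -
        ∫ u in 0..s, dyF (fun v => w v ω i) (fun v => w v ω j) k s u := by
      ext ω
      rw [intervalIntegral.integral_interval_sub_left
        (intervalIntegrable_dyF (hci ω) (hcj ω) k s _ _ le_rfl zero_le_one (by linarith) ht)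
        (intervalIntegrable_dyF (hci ω) (hcj ω) k s _ _ le_rfl zero_le_one hs (by linarith))]
    rw [e]
    refine (pow_le_pow_left₀ (by simp) this 2).trans ?_
    rw [← ENNReal.ofReal_pow (by positivity)]
    apply ENNReal.ofReal_le_ofReal
    have hsq : √(((2 : ℝ) ^ k)⁻¹) ^ 2 = (2 ^ k)⁻¹ := Real.sq_sqrt (by positivity)
    conv_rhs => rw [← hsq]
    apply le_of_eq; ring
  · refine (pow_le_pow_left₀ (by simp) (lemmaA hi hj k s s t hs (by linarith) hs hst ht) 2).trans ?_
    have : 0 ≤ t - s := by linarith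
    rw [← ENNReal.ofReal_pow (by positivity)]
    apply ENNReal.ofReal_le_ofReal
    rw [← mul_pow]
    gcongr
    norm_num

lemma Jint_coord {d : ℕ} (w : ℝ → EuclideanSpace ℝ (Fin d)) (hw : Continuous w) (k : ℕ)
    (s t : ℝ) (hs : 0 ≤ s) (hst : s ≤ t) (ht : t ≤ 1) (i j : Fin d) :
    (Jint (fun v => dyadicApprox (fun u => w u) (k + 1) v - dyadicApprox (fun u => w u) k v)
      (fun v => dyadicApprox (fun u => w u) k v) s t) (i, j) =
    ∫ u in s..t, dyF (fun v => w v i) (fun v => w v j) k s u := by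
  set Z : ℝ → EuclideanSpace ℝ (Fin d) :=
    fun v => dyadicApprox (fun u => w u) (k + 1) v - dyadicApprox (fun u => w u) k v with hZ
  have e : Jint Z (fun v => dyadicApprox (fun u => w u) k v) s t =
      ∫ u in s..t, tensor (Z u - Z s) (dySlope w k u) := by
    unfold Jint
    apply intervalIntegral.integral_congr_ae
    filter_upwards [ae_not_dyadic k] with u hu _
    rw [← deriv_dyadicApprox w k u hu]
  have e2 : ∀ i j u, (tensor (Z u - Z s) (dySlope w k u)) (i, j) =
      dyF (fun v => w v i) (fun v => w v j) k s u := by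
    intro i j u
    simp [tensor, dyF, dyZ, hZ, dySlope_coord, dyadicApprox_coord]
  rw [e, intervalIntegral.integral_of_le hst, intervalIntegral.integral_of_le hst,
    eval_integral_piLp]
  · simp only [e2]
  · rintro ⟨i, j⟩
    simp only [e2]
    have hci : Continuous fun t => w t i := by fun_prop
    have hcj : Continuous fun t => w t j := by fun_prop
    exact (intervalIntegrable_iff_integrableOn_Ioc_of_le hst).1
      (intervalIntegrable_dyF hci hcj k s s t hs (by linarith) (by linarith) ht)

/-- for `z(k) = w(k+1) - w(k)` and the dyadic approximation `w(k)`,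
`E[ |J[z(k), w(k)]_{s,t}|² ] ≤ C_d · min(2^{-k}, (t-s)²)`. -/
theorem statement14 {Ω : Type*} [MeasurableSpace Ω] (P : Measure Ω) (d : ℕ)
    (w : ℝ → Ω → EuclideanSpace ℝ (Fin d))
    (hw : IsBrownianMotion P d w) :
    ∃ C : ℝ, 0 < C ∧ ∀ (k : ℕ) (s t : ℝ), 0 ≤ s → s ≤ t → t ≤ 1 →
      ∫⁻ ω, ENNReal.ofReal
          (‖Jint
              (fun v => dyadicApprox (fun u => w u ω) (k + 1) v
                - dyadicApprox (fun u => w u ω) k v)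
              (fun v => dyadicApprox (fun u => w u ω) k v) s t‖ ^ 2) ∂P
        ≤ ENNReal.ofReal (C * min (((2 : ℝ) ^ k)⁻¹) ((t - s) ^ 2)) := by

  have hP := hw.1
  set c := (eLpNorm id 4 (gaussianReal 0 1)).toReal with hc
  refine ⟨(d : ℝ) ^ 2 * (26 * c ^ 2) ^ 2 + 1, by positivity, fun k s t hs hst ht => ?_⟩
  have hmin : 0 ≤ min (((2 : ℝ) ^ k)⁻¹) ((t - s) ^ 2) := by positivity
  calc _ = ∫⁻ ω, ∑ p : Fin d × Fin d, ENNReal.ofReal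
        ((∫ u in s..t, dyF (fun v => w v ω p.1) (fun v => w v ω p.2) k s u) ^ 2) ∂P := by
        congr 1
        ext ω
        rw [EuclideanSpace.norm_sq_eq, ENNReal.ofReal_sum_of_nonneg (fun _ _ => sq_nonneg _)]
        refine Finset.sum_congr rfl fun p _ => ?_
        rw [Real.norm_eq_abs, sq_abs,
          ← Jint_coord (fun u => w u ω) (hw.2.2.1 ω) k s t hs hst ht p.1 p.2]
    _ = ∑ p : Fin d × Fin d, ∫⁻ ω, ENNReal.ofReal
        ((∫ u in s..t, dyF (fun v => w v ω p.1) (fun v => w v ω p.2) k s u) ^ 2) ∂P := by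
        rw [lintegral_finsetSum]
        intro p _
        have := measurable_G (incBd_of_bm hw p.1).2.1 (incBd_of_bm hw p.2).2.1 k s s t
        exact (this.pow_const 2).ennreal_ofReal
    _ ≤ ∑ p : Fin d × Fin d,
        ENNReal.ofReal ((26 * c ^ 2) ^ 2 * min (((2 : ℝ) ^ k)⁻¹) ((t - s) ^ 2)) :=
        Finset.sum_le_sum fun p _ => bm_final hw p.1 p.2 c hc k s t hs hst ht
    _ ≤ _ := by
        rw [← ENNReal.ofReal_sum_of_nonneg (fun _ _ => by positivity)]
        apply ENNReal.ofReal_le_ofReal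
        simp only [Finset.sum_const, Finset.card_univ, Fintype.card_prod, Fintype.card_fin,
          nsmul_eq_mul]
        push_cast
        nlinarith
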